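/- Let p be a probability mass function on a finite linearly ordered alphabet A, and for a ∈ A let F(a) = Σ_{b < a} p(b) be the left cumulative sum, so that the probability interval of a is [F(a), F(a) + p(a)]. Then for every a with p(a) > 0 there exist natural numbers k_a and M_a < 2^{k_a} with [2^{−k_a}M_a, 2^{−k_a}(M_a + 1)] ⊆ [F(a), F(a) + p(a)] and k_a ≤ ⌊−log₂ p(a)⌋ + 2; the resulting codewords (the k_a-bit binary representations of M_a) form a prefix-free code on {a : p(a) > 0}; and the expected codeword length satisfies Σ_a p(a)·k_a ≤ H(p) + 2, where H(p) = Σ_a −p(a) log₂ p(a) is the Shannon entropy of p in bits. -/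

import Mathlib

open Real

/-- The `k`-bit binary representation (most significant bit first) of a natural number `M`. -/
def kbits (k M : ℕ) : List Bool := (List.range k).map fun i => Nat.testBit M (k - 1 - i)

theorem length_kbits (k M : ℕ) : (kbits k M).length = k := by
  simp [kbits]

/-- If one fixed-length binary representation is a prefix of another, then the shorter number is
obtained from the longer one by dropping the low-order bits. -/
theorem eq_div_two_pow_of_kbits_prefix {k l M N : ℕ} (hM : M < 2 ^ k) (hN : N < 2 ^ l)
    (h : kbits k M <+: kbits l N) : k ≤ l ∧ M = N / 2 ^ (l - k) := by
  have hkl : k ≤ l := by simpa only [length_kbits] using h.length_le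
  refine ⟨hkl, Nat.eq_of_testBit_eq fun j => ?_⟩
  rw [Nat.testBit_div_two_pow]
  by_cases hj : j < k
  · have hget := h.getElem (i := k - 1 - j) (by rw [length_kbits]; omega)
    simp only [kbits, List.getElem_map, List.getElem_range] at hget
    rwa [show k - 1 - (k - 1 - j) = j by omega,
      show l - 1 - (k - 1 - j) = j + (l - k) by omega] at hget
  · rw [Nat.testBit_lt_two_pow (hM.trans_le (Nat.pow_le_pow_right two_pos (by omega))),
      Nat.testBit_lt_two_pow (hN.trans_le (Nat.pow_le_pow_right two_pos (by omega)))]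

/-- If one fixed-length binary representation is a prefix of another, then the dyadic interval of
the longer one meets the interior of the dyadic interval of the shorter one. -/
theorem dyadic_lt_of_kbits_prefix {k l M N : ℕ} (hM : M < 2 ^ k) (hN : N < 2 ^ l)
    (h : kbits k M <+: kbits l N) :
    (M : ℝ) / 2 ^ k < ((N : ℝ) + 1) / 2 ^ l ∧ (N : ℝ) / 2 ^ l < ((M : ℝ) + 1) / 2 ^ k := by
  obtain ⟨hkl, hMN⟩ := eq_div_two_pow_of_kbits_prefix hM hN h
  obtain ⟨d, rfl⟩ := Nat.exists_eq_add_of_le hkl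
  rw [Nat.add_sub_cancel_left] at hMN
  have hlow : M * 2 ^ d ≤ N := hMN ▸ Nat.div_mul_le_self N (2 ^ d)
  have hhigh : N < (M + 1) * 2 ^ d := by
    rw [hMN, ← Nat.div_lt_iff_lt_mul (by positivity)]
    exact Nat.lt_succ_self _
  have hlow' : (M : ℝ) * 2 ^ d ≤ N := mod_cast hlow
  have hhigh' : (N : ℝ) < (M + 1) * 2 ^ d := mod_cast hhigh
  have hk : (0 : ℝ) < 2 ^ k := by positivity
  constructor
  · rw [div_lt_div_iff₀ hk (by positivity), pow_add]
    nlinarith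
  · rw [div_lt_div_iff₀ (by positivity) hk, pow_add]
    nlinarith

/-- An interval `[x, x + q] ⊆ [0, 1]` of positive length contains a dyadic interval of length
`2 ^ (-k)` with `k ≤ ⌊-log₂ q⌋ + 2`. -/
theorem exists_dyadic_subinterval {x q : ℝ} (hx : 0 ≤ x) (hq : 0 < q) (hxq : x + q ≤ 1) :
    ∃ k M : ℕ, M < 2 ^ k ∧ x ≤ (M : ℝ) / 2 ^ k ∧ ((M : ℝ) + 1) / 2 ^ k ≤ x + q ∧
      (k : ℤ) ≤ ⌊-Real.logb 2 q⌋ + 2 := by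
  have hlog : 0 ≤ -Real.logb 2 q := by
    linarith [Real.logb_nonpos one_lt_two hq.le (by linarith : q ≤ 1)]
  obtain ⟨n, hn⟩ := Int.eq_ofNat_of_zero_le (Int.floor_nonneg.mpr hlog)
  have hpow : 2 ≤ q * 2 ^ (n + 2) := by
    have hlt : -Real.logb 2 q < (n : ℝ) + 1 := by
      have := Int.lt_floor_add_one (-Real.logb 2 q)
      rw [hn] at this
      exact_mod_cast this
    have hinv : (2 : ℝ) ^ (-((n : ℝ) + 1)) < q :=
      (Real.lt_logb_iff_rpow_lt one_lt_two hq).mp (by linarith)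
    rw [Real.rpow_neg two_pos.le, ← Nat.cast_add_one, Real.rpow_natCast,
      inv_lt_iff_one_lt_mul₀ (by positivity)] at hinv
    rw [pow_succ]
    linarith
  have hk : (0 : ℝ) < 2 ^ (n + 2) := by positivity
  have hupper : ((⌈x * 2 ^ (n + 2)⌉₊ : ℝ) + 1) / 2 ^ (n + 2) ≤ x + q := by
    rw [div_le_iff₀ hk]
    linarith [Nat.ceil_lt_add_one (mul_nonneg hx hk.le)]
  refine ⟨n + 2, ⌈x * 2 ^ (n + 2)⌉₊, ?_, ?_, hupper, by rw [hn]; simp⟩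
  · have := (div_le_one hk).mp (hupper.trans hxq)
    exact_mod_cast this
  · rw [le_div_iff₀ hk]
    exact Nat.le_ceil _

/-- Arithmetic coding of a single symbol from a finite ordered alphabet with distribution
`p`: each symbol `a` with `p(a) > 0` receives a dyadic interval
`[2^{−kₐ}Mₐ, 2^{−kₐ}(Mₐ+1)]` inside its probability interval `[F(a), F(a)+p(a)]`
(where `F(a) = Σ_{b<a} p(b)`) with `kₐ ≤ ⌊−log₂ p(a)⌋ + 2`; the resulting codewords are
prefix-free, and the expected codeword length is at most `H(p) + 2`. -/
theorem arithmetic_coding_single_symbol {A : Type*} [Fintype A] [LinearOrder A]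
    (p : A → ℝ) (hp0 : ∀ a, 0 ≤ p a) (hp1 : ∑ a, p a = 1)
    (F : A → ℝ) (hF : ∀ a, F a = ∑ b ∈ Finset.univ.filter (fun b => b < a), p b) :
    ∃ (k M : A → ℕ),
      (∀ a, 0 < p a →
        M a < 2 ^ k a ∧
        F a ≤ (M a : ℝ) / 2 ^ k a ∧
        ((M a : ℝ) + 1) / 2 ^ k a ≤ F a + p a ∧
        (k a : ℤ) ≤ ⌊-Real.logb 2 (p a)⌋ + 2) ∧
      (∀ a b, 0 < p a → 0 < p b → a ≠ b →
        ¬ kbits (k a) (M a) <+: kbits (k b) (M b)) ∧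
      (∑ a, p a * (k a : ℝ)) ≤ (∑ a, -(p a) * Real.logb 2 (p a)) + 2 := by
  have hFnonneg : ∀ a, 0 ≤ F a := fun a => hF a ▸ Finset.sum_nonneg fun b _ => hp0 b
  have hadd : ∀ a, F a + p a = ∑ b ∈ Finset.univ.filter (fun b => b ≤ a), p b := fun a => by
    have : Finset.univ.filter (fun b => b ≤ a) =
        insert a (Finset.univ.filter (fun b => b < a)) := by
      ext b
      simp [le_iff_eq_or_lt]
    rw [this, Finset.sum_insert (by simp), hF, add_comm]
  have hone : ∀ a, F a + p a ≤ 1 := fun a => by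
    rw [hadd, ← hp1]
    exact Finset.sum_le_sum_of_subset_of_nonneg (Finset.subset_univ _) fun b _ _ => hp0 b
  have hmono : ∀ a b, a < b → F a + p a ≤ F b := fun a b hab => by
    rw [hadd, hF]
    refine Finset.sum_le_sum_of_subset_of_nonneg (fun c hc => ?_) fun c _ _ => hp0 c
    simp only [Finset.mem_filter, Finset.mem_univ, true_and] at hc ⊢
    exact hc.trans_lt hab
  have hcode : ∀ a, ∃ k M : ℕ, 0 < p a → M < 2 ^ k ∧ F a ≤ (M : ℝ) / 2 ^ k ∧
      ((M : ℝ) + 1) / 2 ^ k ≤ F a + p a ∧ (k : ℤ) ≤ ⌊-Real.logb 2 (p a)⌋ + 2 := fun a => by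
    by_cases ha : 0 < p a
    · obtain ⟨k, M, h⟩ := exists_dyadic_subinterval (hFnonneg a) ha (hone a)
      exact ⟨k, M, fun _ => h⟩
    · exact ⟨0, 0, fun h => absurd h ha⟩
  choose k M hkM using hcode
  refine ⟨k, M, hkM, fun a b ha hb hab hpre => ?_, ?_⟩
  · obtain ⟨hMa, hla, hua, -⟩ := hkM a ha
    obtain ⟨hMb, hlb, hub, -⟩ := hkM b hb
    obtain ⟨h₁, h₂⟩ := dyadic_lt_of_kbits_prefix hMa hMb hpre
    rcases hab.lt_or_gt with h | h
    · linarith [hmono a b h]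
    · linarith [hmono b a h]
  · calc ∑ a, p a * (k a : ℝ) ≤ ∑ a, (-(p a) * Real.logb 2 (p a) + p a * 2) := by
          refine Finset.sum_le_sum fun a _ => ?_
          rcases (hp0 a).eq_or_lt with ha | ha
          · simp [← ha]
          · have hk : (k a : ℝ) ≤ (⌊-Real.logb 2 (p a)⌋ : ℝ) + 2 := mod_cast (hkM a ha).2.2.2
            have hle := Int.floor_le (-Real.logb 2 (p a))
            nlinarith
      _ = (∑ a, -(p a) * Real.logb 2 (p a)) + 2 := by
          rw [Finset.sum_add_distrib, ← Finset.sum_mul, hp1, one_mul]
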